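/- Normalized-payment bound: let S_min > 0, Σ ≥ 0, η ≥ 0, V ≥ 0, K_α ∈ ℕ, and let S, S^α, P, P^α, v_N be real numbers satisfying: S > 0, S^α ≥ S_min, |S^α − S| ≤ Σ, 0 ≤ v_N ≤ V, v_N ≤ S^α, 0 ≤ P ≤ S, and P^α − P ≤ Σ + 2·K_α·η (here S and S^α are the raw semivalue-score sums of the honest and manipulated quotient games, P and P^α are the raw honest and manipulated payments to the latent provider, and v_N is the grand-coalition value, which is invariant under the manipulation). Then the manipulation gain in normalized payments satisfies v_N · P^α / S^α − v_N · P / S ≤ Σ + 2·K_α·η + V·Σ/S_min. -/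

import Mathlib

/-- Normalized-payment bound: for raw score sums `S, Sα`, raw payments
`P, Pα`, and grand-coalition value `vN` satisfying the stated bounds, the
manipulation gain in normalized payments `vN * P / S` is at most
`Σ + 2 * K_α * η + V * Σ / S_min`. -/
theorem normalized_payment_bound
    (Smin Sig η V : ℝ) (Kα : ℕ) (S Sα P Pα vN : ℝ)
    (hSmin : 0 < Smin) (hSig : 0 ≤ Sig) (hη : 0 ≤ η) (hV : 0 ≤ V)
    (hS : 0 < S) (hSα : Smin ≤ Sα) (hdiff : |Sα - S| ≤ Sig)
    (hvN0 : 0 ≤ vN) (hvNV : vN ≤ V) (hvNSα : vN ≤ Sα)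
    (hP0 : 0 ≤ P) (hPS : P ≤ S)
    (hgain : Pα - P ≤ Sig + 2 * (Kα : ℝ) * η) :
    vN * Pα / Sα - vN * P / S ≤ Sig + 2 * (Kα : ℝ) * η + V * Sig / Smin := by
  have hSα0 : 0 < Sα := hSmin.trans_le hSα
  have hbudget : 0 ≤ Sig + 2 * (Kα : ℝ) * η := by positivity
  have hsplit : vN * Pα / Sα - vN * P / S =
      vN / Sα * (Pα - P) + vN * (P / S) * (S - Sα) / Sα := by
    field_simp
    ring
  have hraw : vN / Sα * (Pα - P) ≤ Sig + 2 * (Kα : ℝ) * η :=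
    (mul_le_mul_of_nonneg_left hgain (by positivity)).trans
      (mul_le_of_le_one_left hbudget ((div_le_one hSα0).2 hvNSα))
  have hshare : vN * (P / S) ≤ V :=
    (mul_le_of_le_one_right hvN0 ((div_le_one hS).2 hPS)).trans hvNV
  have hdrift : S - Sα ≤ Sig := by linarith [(abs_le.1 hdiff).1]
  have hrescale : vN * (P / S) * (S - Sα) / Sα ≤ V * Sig / Smin :=
    calc vN * (P / S) * (S - Sα) / Sα ≤ vN * (P / S) * Sig / Sα := by gcongr
      _ ≤ V * Sig / Smin := by gcongr
  linarith
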